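/- A generic monomial ideal M in k[x_1,…,x_n] is Cohen-Macaulay if and only if dim(Δ_M) + dim(V(M)) = n − 2, where Δ_M is the Scarf complex of M and V(M) is the simplicial complex with Stanley-Reisner ideal rad(M). -/

import Mathlib

open Finset

open scoped Classical

set_option synthInstance.maxHeartbeats 1000000

/-- The monomial `x^a` in `k[x_1,…,x_n]` with exponent vector `a : Fin n → ℕ`. -/
noncomputable def mono (k : Type*) [CommSemiring k] {n : ℕ} (a : Fin n → ℕ) :
    MvPolynomial (Fin n) k :=
  MvPolynomial.monomial (Finsupp.equivFunOnFinite.symm a) 1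

/-- The monomial ideal generated by the monomials with exponent vectors in `G`. -/
noncomputable def monIdeal (k : Type*) [CommSemiring k] {n : ℕ}
    (G : Finset (Fin n → ℕ)) : Ideal (MvPolynomial (Fin n) k) :=
  Ideal.span ((fun a => mono k a) '' (G : Set (Fin n → ℕ)))

/-- Exponent vector of the lcm of the monomials with exponents in `σ`. -/
def lcmExp {n : ℕ} (σ : Finset (Fin n → ℕ)) : Fin n → ℕ :=
  fun i => σ.sup (fun a => a i)

/-- `c` strictly divides `b`: whenever `c` has positive degree in a variable,
its degree there is strictly smaller than that of `b`. -/
def StrictlyDivides {n : ℕ} (c b : Fin n → ℕ) : Prop :=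
  ∀ i, 0 < c i → c i < b i

/-- `G` is the set of exponent vectors of the minimal generators of a *generic*
monomial ideal: no generator divides another, and for any two distinct
generators with the same positive degree in some variable there is a third
generator strictly dividing their lcm. -/
def IsGeneric {n : ℕ} (G : Finset (Fin n → ℕ)) : Prop :=
  (∀ a ∈ G, ∀ b ∈ G, a ≤ b → a = b) ∧
  ∀ a ∈ G, ∀ b ∈ G, a ≠ b → (∃ h, a h = b h ∧ 0 < a h) →
    ∃ c ∈ G, c ≠ a ∧ c ≠ b ∧ StrictlyDivides c (fun i => max (a i) (b i))

/-- `σ ⊆ G` is a face of the Scarf complex of the monomial ideal with minimal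
generating exponents `G`: its lcm is attained by no other subset of `G`. -/
def ScarfFace {n : ℕ} (G σ : Finset (Fin n → ℕ)) : Prop :=
  σ ⊆ G ∧ ∀ τ ⊆ G, τ ≠ σ → lcmExp τ ≠ lcmExp σ

/-- The dimension (as an integer, so the empty-complex value `-1` is allowed)
of the Scarf complex `Δ_M`: one less than the largest cardinality of a face. -/
noncomputable def scarfDim {n : ℕ} (G : Finset (Fin n → ℕ)) : ℤ :=
  (((G.powerset.filter (fun σ => ScarfFace G σ)).sup Finset.card : ℕ) : ℤ) - 1

/-- `σ` is a face of `V(M)`, the simplicial complex whose Stanley-Reisner ideal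
is `rad M`: no generator of `M` has support contained in `σ`. -/
def VFace {n : ℕ} (G : Finset (Fin n → ℕ)) (σ : Finset (Fin n)) : Prop :=
  ∀ a ∈ G, ¬ (Finset.univ.filter (fun i => 0 < a i) ⊆ σ)

/-- The dimension of `V(M)` as an integer. -/
noncomputable def vDim {n : ℕ} (G : Finset (Fin n → ℕ)) : ℤ :=
  ((((Finset.univ : Finset (Fin n)).powerset.filter (fun σ => VFace G σ)).sup
    Finset.card : ℕ) : ℤ) - 1

/-- The quotient `S/I` of the polynomial ring `S = k[x_1,…,x_n]` is
Cohen-Macaulay: some regular sequence on `S/I` consisting of elements of the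
irrelevant maximal ideal `⟨x_1,…,x_n⟩` has length equal to the Krull dimension
of `S/I`. -/
def IsCMQuotient (k : Type*) [Field k] {n : ℕ}
    (I : Ideal (MvPolynomial (Fin n) k)) : Prop :=
  ∃ rs : List (MvPolynomial (Fin n) k),
    (∀ r ∈ rs, r ∈ Ideal.span (Set.range (MvPolynomial.X : Fin n → MvPolynomial (Fin n) k))) ∧
    RingTheory.Sequence.IsRegular (MvPolynomial (Fin n) k ⧸ I)
      (rs.map (Ideal.Quotient.mk I)) ∧
    (rs.length : WithBot (WithTop ℕ)) = ringKrullDim (MvPolynomial (Fin n) k ⧸ I)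

open RingTheory.Sequence in
theorem RingTheory.Sequence.IsWeaklyRegular.of_exact {R : Type*} [CommRing R] {rs : List R}
    {M₁ M₂ M₃ : Type*} [AddCommGroup M₁] [AddCommGroup M₂] [AddCommGroup M₃]
    [Module R M₁] [Module R M₂] [Module R M₃] {f : M₁ →ₗ[R] M₂} {g : M₂ →ₗ[R] M₃}
    (hf : Function.Injective f) (hfg : Function.Exact f g) (hg : Function.Surjective g)
    (h₁ : IsWeaklyRegular M₁ rs) (h₃ : IsWeaklyRegular M₃ rs) : IsWeaklyRegular M₂ rs := by
  induction rs generalizing M₁ M₂ M₃ with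
  | nil => exact IsWeaklyRegular.nil R M₂
  | cons r rs ih =>
    rw [isWeaklyRegular_cons_iff] at h₁ h₃ ⊢
    refine ⟨isSMulRegular_of_range_eq_ker hf hfg.linearMap_ker_eq.symm h₁.1 h₃.1, ?_⟩
    refine ih (f := QuotSMulTop.map r f) (g := QuotSMulTop.map r g) ?_
      (QuotSMulTop.map_exact r hfg hg) (QuotSMulTop.map_surjective r hg) h₁.2 h₃.2
    have h0 : Function.Exact (0 : M₁ →ₗ[R] M₁) f := by
      rw [LinearMap.exact_iff, LinearMap.ker_eq_bot.mpr hf, LinearMap.range_zero]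
    have := QuotSMulTop.map_first_exact_on_four_term_exact_of_isSMulRegular_last h0 hfg h₃.1
    rw [← LinearMap.ker_eq_bot, this.linearMap_ker_eq, eq_bot_iff]
    rintro _ ⟨y, rfl⟩
    obtain ⟨z, rfl⟩ := Submodule.mkQ_surjective _ y
    simp

open Pointwise in
/-- Multiplication by a regular element produces an associated prime strictly above a given one,
inside any prime containing both. -/
theorem exists_associatedPrime_quotSMulTop_gt {R M : Type*} [CommRing R] [IsNoetherianRing R]
    [AddCommGroup M] [Module R M] [Module.Finite R M] {m P : Ideal R} [m.IsPrime] {x : R}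
    (hx : x ∈ m) (hreg : IsSMulRegular M x) (hP : P ∈ associatedPrimes R M) (hPm : P ≤ m) :
    ∃ Q ∈ associatedPrimes R (QuotSMulTop x M), P < Q ∧ Q ≤ m := by
  obtain ⟨hPp, z, hz⟩ := isAssociatedPrime_iff.mp hP
  have hzP : ∀ s : R, s • z = 0 ↔ s ∈ P := fun s => by
    rw [hz, Submodule.mem_colon_singleton, Submodule.mem_bot]
  let N : Submodule R M := Submodule.torsionBySet R M (P : Set R)
  have hN : ∀ y : M, y ∈ N ↔ ∀ s ∈ P, s • y = 0 := fun y => by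
    simp [N, Submodule.mem_torsionBySet_iff]
  have hzN : z ∈ N := (hN z).2 fun s hs => (hzP s).2 hs
  let N' : Submodule R (QuotSMulTop x M) := N.map (x • (⊤ : Submodule R M)).mkQ
  have hann : Module.annihilator R N' ≤ m := by
    rw [← Module.mem_support_iff_of_finite (p := ⟨m, inferInstance⟩)]
    by_contra hm
    obtain ⟨s, hsann, hsm⟩ : ∃ s ∈ Module.annihilator R N', s ∉ m := by
      rw [Module.mem_support_iff_of_finite] at hm
      exact Set.not_subset.mp hm
    have hsN : ∀ y ∈ N, ∃ w ∈ N, x • w = s • y := by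
      intro y hy
      have h1 := Module.mem_annihilator.mp hsann ⟨_, Submodule.mem_map_of_mem hy⟩
      have h2 : (x • (⊤ : Submodule R M)).mkQ (s • y) = 0 := by
        simpa [Subtype.ext_iff] using h1
      rw [Submodule.mkQ_apply, Submodule.Quotient.mk_eq_zero,
        Submodule.mem_smul_pointwise_iff_exists] at h2
      obtain ⟨w, -, hw⟩ := h2
      refine ⟨w, (hN w).2 fun t ht => hreg.right_eq_zero_of_smul ?_, hw⟩
      rw [smul_comm, hw, smul_comm, (hN y).1 hy t ht, smul_zero]
    obtain ⟨p, hp, -, hc, hp0⟩ :=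
      LinearMap.exists_monic_and_natDegree_eq_and_coeff_mem_pow_and_aeval_eq_zero
        (R := R) (M := N) (algebraMap R (Module.End R N) s) (Ideal.span {x}) (by
          rintro _ ⟨y, rfl⟩
          obtain ⟨w, hw, hwy⟩ := hsN y y.2
          rw [Submodule.ideal_span_singleton_smul, Submodule.mem_smul_pointwise_iff_exists]
          exact ⟨⟨w, hw⟩, trivial, Subtype.ext hwy⟩)
    have h3 : p.eval s ∈ P := by
      rw [← hzP]
      have h4 := congrArg (fun f : Module.End R N => ((f ⟨z, hzN⟩ : N) : M)) hp0
      rw [Polynomial.aeval_algebraMap_apply] at h4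
      simpa [Module.algebraMap_end_apply] using h4
    have h5 : p.eval s - s ^ p.natDegree ∈ m := by
      rw [Polynomial.eval_eq_sum_range, Finset.sum_range_succ, hp.coeff_natDegree, one_mul,
        add_sub_cancel_right]
      refine Ideal.sum_mem _ fun i hi => Ideal.mul_mem_right _ _ ?_
      have hi' : p.natDegree - i ≠ 0 := by have := Finset.mem_range.mp hi; omega
      exact (Ideal.span_singleton_le_iff_mem _).2 hx (Ideal.pow_le_self hi' (hc i))
    refine hsm (Ideal.IsPrime.mem_of_pow_mem inferInstance p.natDegree ?_)
    simpa using m.sub_mem (hPm h3) h5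
  obtain ⟨Q, hQ, hQm⟩ := Ideal.exists_minimalPrimes_le hann
  have hQN := Module.associatedPrimes.minimalPrimes_annihilator_subset_associatedPrimes R N' hQ
  refine ⟨Q, associatedPrimes.subset_of_injective N'.injective_subtype hQN,
    lt_of_le_of_ne ?_ ?_, hQm⟩
  · refine le_trans (fun s hs => ?_) hQ.1.2
    rw [Module.mem_annihilator]
    rintro ⟨_, y, hy, rfl⟩
    refine Subtype.ext ?_
    change s • (x • (⊤ : Submodule R M)).mkQ y = 0
    rw [← map_smul, (hN y).1 hy s hs, map_zero]
  · rintro rfl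
    have hxP : x ∈ P := by
      refine hQ.1.2 ?_
      rw [Module.mem_annihilator]
      rintro ⟨y, hy⟩
      refine Subtype.ext ?_
      exact Module.mem_annihilator.mp (QuotSMulTop.mem_annihilator M x) y
    have := hreg.right_eq_zero_of_smul ((hzP x).2 hxP)
    exact hPp.ne_top ((Ideal.eq_top_iff_one P).2 ((hzP 1).1 (by rw [this, smul_zero])))

open RingTheory.Sequence in
theorem height_add_length_le_of_isWeaklyRegular {R M : Type*} [CommRing R] [IsNoetherianRing R]
    [AddCommGroup M] [Module R M] [Module.Finite R M] {m P : Ideal R} [m.IsPrime] {rs : List R}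
    (hrs : ∀ r ∈ rs, r ∈ m) (hreg : IsWeaklyRegular M rs) (hP : P ∈ associatedPrimes R M)
    (hPm : P ≤ m) : P.height + rs.length ≤ m.height := by
  induction rs generalizing M P with
  | nil => simpa using Ideal.height_mono hPm
  | cons r rs ih =>
    rw [isWeaklyRegular_cons_iff] at hreg
    obtain ⟨Q, hQ, hPQ, hQm⟩ :=
      exists_associatedPrime_quotSMulTop_gt (hrs r List.mem_cons_self) hreg.1 hP hPm
    have := hP.isPrime
    have := hQ.isPrime
    calc P.height + ((r :: rs).length : ℕ) = P.height + 1 + rs.length := by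
          rw [List.length_cons]; push_cast; ring
      _ ≤ Q.height + rs.length := by
          gcongr
          exact Ideal.height_add_one_le_of_lt_of_isPrime hPQ
      _ ≤ m.height := ih (fun s hs => hrs s (List.mem_cons_of_mem _ hs)) hreg.2 hQ hQm

section MonomialIdeals

open MvPolynomial RingTheory.Sequence

variable {n : ℕ}

/-- The monomial with exponent vector `w` lies in the monomial ideal generated by `G`. -/
def MonMem (G : Finset (Fin n → ℕ)) (w : Fin n → ℕ) : Prop :=
  ∃ a ∈ G, a ≤ w

/-- Exponents of generators of the colon ideal of `⟨x^a : a ∈ G⟩` by `x^w`. -/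
noncomputable def colonGens (G : Finset (Fin n → ℕ)) (w : Fin n → ℕ) : Finset (Fin n → ℕ) :=
  G.image (fun a => a - w)

theorem MonMem.mono_right {G : Finset (Fin n → ℕ)} {v w : Fin n → ℕ} (h : MonMem G v)
    (hvw : v ≤ w) : MonMem G w :=
  h.imp fun _ ha => ⟨ha.1, ha.2.trans hvw⟩

theorem monMem_colonGens {G : Finset (Fin n → ℕ)} {v w : Fin n → ℕ} :
    MonMem (colonGens G w) v ↔ MonMem G (w + v) := by
  simp [MonMem, colonGens, add_comm w v]

theorem monMem_insert {G : Finset (Fin n → ℕ)} {v w : Fin n → ℕ} :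
    MonMem (insert w G) v ↔ w ≤ v ∨ MonMem G v := by
  simp [MonMem]

/-- Exponents of the generators of the monomial prime ideal `⟨x_i : i ∈ T⟩`. -/
noncomputable def varGens (T : Finset (Fin n)) : Finset (Fin n → ℕ) :=
  T.image (fun i => Pi.single i 1)

theorem single_le_iff {i : Fin n} {e : ℕ} {w : Fin n → ℕ} : Pi.single i e ≤ w ↔ e ≤ w i := by
  refine ⟨fun h => by simpa using h i, fun h j => ?_⟩
  obtain rfl | hj := eq_or_ne j i <;> simp [*]

theorem monMem_varGens {T : Finset (Fin n)} {w : Fin n → ℕ} :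
    MonMem (varGens T) w ↔ ∃ i ∈ T, 0 < w i := by
  simp [MonMem, varGens, single_le_iff, Nat.one_le_iff_ne_zero, Nat.pos_iff_ne_zero]

variable {k : Type*} [Field k]

theorem mem_monIdeal {G : Finset (Fin n → ℕ)} {p : MvPolynomial (Fin n) k} :
    p ∈ monIdeal k G ↔ ∀ s, coeff s p ≠ 0 → MonMem G s := by
  have : monIdeal k G = Ideal.span ((fun s : Fin n →₀ ℕ => monomial s (1 : k)) ''
      (Finsupp.equivFunOnFinite.symm '' (G : Set (Fin n → ℕ)))) := by
    rw [Set.image_image]; rfl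
  rw [this, mem_ideal_span_monomial_image]
  simp only [mem_support_iff, MonMem, Set.exists_mem_image, Finset.mem_coe]
  rfl

theorem mono_mem_monIdeal {G : Finset (Fin n → ℕ)} {w : Fin n → ℕ} :
    mono k w ∈ monIdeal k G ↔ MonMem G w := by
  simp [mem_monIdeal, mono, coeff_monomial]

theorem monIdeal_le_of_forall {G H : Finset (Fin n → ℕ)} (h : ∀ w, MonMem G w → MonMem H w) :
    monIdeal k G ≤ monIdeal k H := fun _ hp =>
  mem_monIdeal.2 fun s hs => h s (mem_monIdeal.1 hp s hs)

theorem monIdeal_congr {G H : Finset (Fin n → ℕ)} (h : ∀ w, MonMem G w ↔ MonMem H w) :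
    monIdeal k G = monIdeal k H :=
  le_antisymm (monIdeal_le_of_forall fun w => (h w).1) (monIdeal_le_of_forall fun w => (h w).2)

theorem monIdeal_insert (G : Finset (Fin n → ℕ)) (w : Fin n → ℕ) :
    monIdeal k (insert w G) = Ideal.span {mono k w} ⊔ monIdeal k G := by
  rw [monIdeal, Finset.coe_insert, Set.image_insert_eq, Ideal.span_insert]
  rfl

theorem mono_mul_mem_monIdeal {G : Finset (Fin n → ℕ)} {w : Fin n → ℕ}
    {p : MvPolynomial (Fin n) k} :
    mono k w * p ∈ monIdeal k G ↔ p ∈ monIdeal k (colonGens G w) := by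
  simp only [mem_monIdeal, monMem_colonGens]
  refine ⟨fun h s hs => ?_, fun h s hs => ?_⟩
  · simpa using h (Finsupp.equivFunOnFinite.symm w + s) (by simpa [mono, coeff_monomial_mul])
  · rw [mono, coeff_monomial_mul'] at hs
    split_ifs at hs with hws
    · obtain ⟨t, rfl⟩ := exists_add_of_le hws
      simpa using h t (by simpa using hs)
    · exact absurd rfl hs

/-- Weak regularity of `rs` on `S/I` follows from that on `S/(I : x^w)` and `S/(I + x^w)`. -/
theorem isWeaklyRegular_monIdeal_of_colon {rs : List (MvPolynomial (Fin n) k)}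
    {G : Finset (Fin n → ℕ)} (w : Fin n → ℕ)
    (h₁ : IsWeaklyRegular (MvPolynomial (Fin n) k ⧸ monIdeal k (colonGens G w)) rs)
    (h₂ : IsWeaklyRegular (MvPolynomial (Fin n) k ⧸ monIdeal k (insert w G)) rs) :
    IsWeaklyRegular (MvPolynomial (Fin n) k ⧸ monIdeal k G) rs := by
  have hle : monIdeal k G ≤ monIdeal k (insert w G) :=
    monIdeal_le_of_forall fun v hv => monMem_insert.2 (Or.inr hv)
  let f := Submodule.mapQ (monIdeal k (colonGens G w)) (monIdeal k G)
    (LinearMap.mulLeft (MvPolynomial (Fin n) k) (mono k w))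
    fun p hp => mono_mul_mem_monIdeal.2 hp
  let g := Submodule.factor hle
  have hf : Function.Injective f := by
    rw [injective_iff_map_eq_zero]
    intro x hx
    obtain ⟨p, rfl⟩ := Submodule.mkQ_surjective _ x
    rw [Submodule.mkQ_apply, Submodule.Quotient.mk_eq_zero]
    exact mono_mul_mem_monIdeal.1 ((Submodule.Quotient.mk_eq_zero _).1 hx)
  have hg : Function.Surjective g := Submodule.factor_surjective hle
  refine IsWeaklyRegular.of_exact (f := f) (g := g) hf ?_ hg h₁ h₂
  intro y
  obtain ⟨q, rfl⟩ := Submodule.mkQ_surjective _ y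
  constructor
  · intro hq
    have hq' : q ∈ monIdeal k (insert w G) := (Submodule.Quotient.mk_eq_zero _).1 hq
    rw [monIdeal_insert, Submodule.mem_sup] at hq'
    obtain ⟨_, ha, b, hb, rfl⟩ := hq'
    obtain ⟨c, rfl⟩ := Ideal.mem_span_singleton'.1 ha
    refine ⟨Submodule.mkQ _ c, ?_⟩
    refine (Submodule.Quotient.eq _).2 ?_
    simpa [mul_comm] using hb
  · rintro ⟨x, hx⟩
    obtain ⟨p, rfl⟩ := Submodule.mkQ_surjective _ x
    rw [← hx]
    refine (Submodule.Quotient.mk_eq_zero _).2 (Ideal.mul_mem_right _ _ ?_)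
    exact mono_mem_monIdeal.2 (monMem_insert.2 (Or.inl le_rfl))

theorem isWeaklyRegular_monIdeal_of_monMem_zero {rs : List (MvPolynomial (Fin n) k)}
    {G : Finset (Fin n → ℕ)} (h : MonMem G 0) :
    IsWeaklyRegular (MvPolynomial (Fin n) k ⧸ monIdeal k G) rs := by
  have htop : monIdeal k G = ⊤ := by
    rw [eq_top_iff]
    exact fun p _ => mem_monIdeal.2 fun s _ => h.mono_right fun _ => Nat.zero_le _
  have : Subsingleton (MvPolynomial (Fin n) k ⧸ monIdeal k G) := by
    rw [htop]; infer_instance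
  induction rs with
  | nil => exact IsWeaklyRegular.nil _ _
  | cons r rs _ =>
    rw [isWeaklyRegular_iff]
    intro i hi
    have := (Submodule.mkQ_surjective (Ideal.ofList (((r :: rs).take i)) •
      (⊤ : Submodule (MvPolynomial (Fin n) k) (MvPolynomial (Fin n) k ⧸ monIdeal k G)))).subsingleton
    exact Function.injective_of_subsingleton _

theorem mem_monIdeal_varGens {T : Finset (Fin n)} {p : MvPolynomial (Fin n) k} :
    p ∈ monIdeal k (varGens T) ↔ ∀ s, coeff s p ≠ 0 → ∃ i ∈ T, 0 < s i := by
  simp only [mem_monIdeal, monMem_varGens]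

theorem X_mem_monIdeal_varGens {T : Finset (Fin n)} {i : Fin n} :
    (X i : MvPolynomial (Fin n) k) ∈ monIdeal k (varGens T) ↔ i ∈ T := by
  rw [mem_monIdeal_varGens]
  simp [coeff_X, Finsupp.single_apply, Nat.pos_iff_ne_zero]

theorem monIdeal_varGens_eq_span (T : Finset (Fin n)) :
    monIdeal k (varGens T) = Ideal.span (X '' (T : Set (Fin n))) := by
  ext p
  rw [mem_monIdeal_varGens, mem_ideal_span_X_image]
  simp [Nat.pos_iff_ne_zero]

instance isPrime_monIdeal_varGens (T : Finset (Fin n)) : (monIdeal k (varGens T)).IsPrime := by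
  let φ : MvPolynomial (Fin n) k →ₐ[k] MvPolynomial (Fin n) k :=
    aeval fun i => if i ∈ T then 0 else X i
  have hφ : ∀ p, p - φ p ∈ monIdeal k (varGens T) := by
    intro p
    rw [← Ideal.Quotient.eq]
    have : (Ideal.Quotient.mkₐ k (monIdeal k (varGens T))) =
        (Ideal.Quotient.mkₐ k (monIdeal k (varGens T))).comp φ := by
      ext i
      by_cases hi : i ∈ T
      · simpa [φ, hi] using Ideal.Quotient.eq_zero_iff_mem.2 (X_mem_monIdeal_varGens.2 hi)
      · simp [φ, hi]
    exact DFunLike.congr_fun this p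
  have hker : monIdeal k (varGens T) = RingHom.ker φ := by
    apply le_antisymm
    · rw [monIdeal_varGens_eq_span, Ideal.span_le]
      rintro _ ⟨i, hi, rfl⟩
      simp [φ, RingHom.mem_ker, Finset.mem_coe.1 hi]
    · intro p hp
      simpa [RingHom.mem_ker.1 hp] using hφ p
  rw [hker]
  exact RingHom.ker_isPrime _

theorem sum_single_apply (A : Finset (Fin n)) (i : Fin n) :
    (∑ j ∈ A, Finsupp.single j 1 : Fin n →₀ ℕ) i = if i ∈ A then 1 else 0 := by
  simp [Finsupp.finsetSum_apply, Finsupp.single_apply]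

/-- The sequence `e_d, e_{d-1}, …, e_1` of elementary symmetric polynomials. -/
noncomputable def esymmSeq (k : Type*) [Field k] (n : ℕ) : ℕ → List (MvPolynomial (Fin n) k)
  | 0 => []
  | d + 1 => esymm (Fin n) k (d + 1) :: esymmSeq k n d

theorem length_esymmSeq (d : ℕ) : (esymmSeq k n d).length = d := by
  induction d with
  | zero => rfl
  | succ d ih => simp [esymmSeq, ih]

/-- Exponent vector of the squarefree monomial with support `A`. -/
noncomputable def sqfree (A : Finset (Fin n)) : Fin n → ℕ := fun i => if i ∈ A then 1 else 0

theorem sqfree_le_iff {A : Finset (Fin n)} {w : Fin n → ℕ} :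
    sqfree A ≤ w ↔ ∀ i ∈ A, 0 < w i := by
  refine forall_congr' fun i => ?_
  by_cases hi : i ∈ A <;> simp [sqfree, hi, Nat.one_le_iff_ne_zero, Nat.pos_iff_ne_zero]

theorem esymm_sub_mono_mem {T : Finset (Fin n)} :
    esymm (Fin n) k Tᶜ.card - mono k (sqfree Tᶜ) ∈ monIdeal k (varGens T) := by
  have hmem : Tᶜ ∈ Finset.powersetCard Tᶜ.card (Finset.univ : Finset (Fin n)) := by simp
  have hmono : mono k (sqfree Tᶜ) = monomial (∑ i ∈ Tᶜ, Finsupp.single i 1) (1 : k) := by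
    rw [mono]
    congr 2
    ext i
    rw [sum_single_apply]
    rfl
  rw [esymm_eq_sum_monomial, ← Finset.add_sum_erase _ _ hmem, hmono, add_sub_cancel_left]
  refine Ideal.sum_mem _ fun A hA => mem_monIdeal_varGens.2 fun s hs => ?_
  obtain ⟨hne, hcard⟩ : A ≠ Tᶜ ∧ A.card = Tᶜ.card := by simpa using hA
  rw [coeff_monomial] at hs
  obtain rfl : ∑ i ∈ A, Finsupp.single i 1 = s := by by_contra h; simp [h] at hs
  obtain ⟨i, hiA, hiT⟩ : ∃ i ∈ A, i ∉ Tᶜ := by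
    by_contra! h
    exact hne (Finset.eq_of_subset_of_card_le h hcard.ge)
  exact ⟨i, by simpa using hiT, by rw [sum_single_apply, if_pos hiA]; exact one_pos⟩

theorem isWeaklyRegular_insert_sqfree {rs : List (MvPolynomial (Fin n) k)} {T : Finset (Fin n)}
    (h : ∀ i ∉ T, IsWeaklyRegular (MvPolynomial (Fin n) k ⧸ monIdeal k (varGens (insert i T))) rs)
    (A : Finset (Fin n)) (hA : Disjoint A T) :
    IsWeaklyRegular (MvPolynomial (Fin n) k ⧸ monIdeal k (insert (sqfree A) (varGens T))) rs := by
  induction A using Finset.induction_on with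
  | empty =>
    refine isWeaklyRegular_monIdeal_of_monMem_zero (monMem_insert.2 (Or.inl ?_))
    exact sqfree_le_iff.2 (by simp)
  | insert i A hi ih =>
    rw [Finset.disjoint_insert_left] at hA
    refine isWeaklyRegular_monIdeal_of_colon (Pi.single i 1) ?_ ?_
    · have := ih hA.2
      rwa [monIdeal_congr (H := colonGens (insert (sqfree (insert i A)) (varGens T))
        (Pi.single i 1))] at this
      intro w
      simp only [monMem_colonGens, monMem_insert, sqfree_le_iff, monMem_varGens, Pi.add_apply,
        Finset.forall_mem_insert, Pi.single_eq_same]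
      refine or_congr ⟨fun h => ⟨by omega, fun j hj => by have := h j hj; omega⟩, fun h j hj => ?_⟩
        ⟨fun ⟨j, hj, h⟩ => ⟨j, hj, by omega⟩, fun ⟨j, hj, h⟩ => ⟨j, hj, ?_⟩⟩
      · have := h.2 j hj
        rwa [Pi.single_eq_of_ne (by rintro rfl; exact hi hj), zero_add] at this
      · rwa [Pi.single_eq_of_ne (by rintro rfl; exact hA.1 hj), zero_add] at h
    · have := h i hA.1
      rwa [monIdeal_congr (H := insert (Pi.single i 1)
        (insert (sqfree (insert i A)) (varGens T)))] at this
      intro w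
      simp only [monMem_insert, sqfree_le_iff, monMem_varGens, single_le_iff,
        Finset.forall_mem_insert, Finset.exists_mem_insert, Nat.one_le_iff_ne_zero,
        Nat.pos_iff_ne_zero]
      tauto

open Pointwise in
theorem isWeaklyRegular_esymmSeq (d : ℕ) (T : Finset (Fin n)) (hT : T.card + d = n) :
    IsWeaklyRegular (MvPolynomial (Fin n) k ⧸ monIdeal k (varGens T)) (esymmSeq k n d) := by
  induction d generalizing T with
  | zero => exact IsWeaklyRegular.nil _ _
  | succ d ih =>
    have hcard : Tᶜ.card = d + 1 := by rw [Finset.card_compl, Fintype.card_fin]; omega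
    have hsub := esymm_sub_mono_mem (k := k) (T := T)
    rw [hcard] at hsub
    rw [esymmSeq, isWeaklyRegular_cons_iff]
    constructor
    · rw [isSMulRegular_quotient_iff_mem_of_smul_mem]
      intro p hp
      refine ((isPrime_monIdeal_varGens T).mem_or_mem hp).resolve_left fun he => ?_
      have := sub_mem he hsub
      rw [sub_sub_cancel, mono_mem_monIdeal, monMem_varGens] at this
      obtain ⟨i, hi, h0⟩ := this
      simp [sqfree, hi] at h0
    · have h1 := isWeaklyRegular_insert_sqfree (rs := esymmSeq k n d) (T := T)
        (fun i hi => ih _ (by rw [Finset.card_insert_of_notMem hi]; omega)) Tᶜ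
        disjoint_compl_left
      have heq : monIdeal k (insert (sqfree Tᶜ) (varGens T)) =
          monIdeal k (varGens T) ⊔ esymm (Fin n) k (d + 1) • ⊤ := by
        rw [monIdeal_insert, sup_comm, ← Submodule.ideal_span_singleton_smul, smul_eq_mul,
          Ideal.mul_top]
        apply le_antisymm <;> refine sup_le le_sup_left ?_ <;>
          rw [Ideal.span_singleton_le_iff_mem]
        · simpa using sub_mem (Ideal.mem_sup_right (S := monIdeal k (varGens T))
            (Ideal.mem_span_singleton_self (esymm (Fin n) k (d + 1))))
            (Ideal.mem_sup_left hsub)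
        · simpa using add_mem (Ideal.mem_sup_left (T := Ideal.span {mono k (sqfree Tᶜ)}) hsub)
            (Ideal.mem_sup_right (Ideal.mem_span_singleton_self (mono k (sqfree Tᶜ))))
      let e := Submodule.quotEquivOfEq _ _ heq ≪≫ₗ
        (Submodule.quotientQuotientEquivQuotientSup (monIdeal k (varGens T))
          (esymm (Fin n) k (d + 1) • ⊤)).symm ≪≫ₗ
        Submodule.quotEquivOfEq _ (esymm (Fin n) k (d + 1) • ⊤)
          (by rw [Submodule.map_pointwise_smul, Submodule.map_top, Submodule.range_mkQ])
      exact (e.isWeaklyRegular_congr _).1 h1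

end MonomialIdeals

section GenericFiltration

open MvPolynomial RingTheory.Sequence

variable {n : ℕ}

/-- Genericity of a possibly non-minimal set of generators. -/
def GenericGens (G : Finset (Fin n → ℕ)) : Prop :=
  ∀ a ∈ G, ∀ b ∈ G, a ≠ b → (∃ h, a h = b h ∧ 0 < a h) → ∃ c ∈ G, StrictlyDivides c (a ⊔ b)

/-- The prime `⟨x_i : i ∈ T⟩` is of the form `M : x^u` for a monomial `x^u`. -/
def ColonPrime (G : Finset (Fin n → ℕ)) (T : Finset (Fin n)) : Prop :=
  ∃ u : Fin n → ℕ, ∀ w, MonMem G (u + w) ↔ ∃ i ∈ T, 0 < w i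

theorem IsGeneric.genericGens {G : Finset (Fin n → ℕ)} (hG : IsGeneric G) : GenericGens G := by
  intro a ha b hb hab h
  obtain ⟨c, hc, -, -, hcd⟩ := hG.2 a ha b hb hab h
  exact ⟨c, hc, hcd⟩

theorem GenericGens.colonGens {G : Finset (Fin n → ℕ)} (hG : GenericGens G) (w : Fin n → ℕ) :
    GenericGens (colonGens G w) := by
  rintro a' ha b' hb hab ⟨h, hh, hpos⟩
  obtain ⟨a, haG, rfl⟩ := Finset.mem_image.1 ha
  obtain ⟨b, hbG, rfl⟩ := Finset.mem_image.1 hb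
  simp only [Pi.sub_apply] at hh hpos
  obtain ⟨c, hc, hcd⟩ := hG a haG b hbG (by rintro rfl; exact hab rfl) ⟨h, by omega, by omega⟩
  refine ⟨c - w, mem_image_of_mem _ hc, fun i hi => ?_⟩
  have := hcd i
  simp only [Pi.sub_apply, Pi.sup_apply] at *
  omega

theorem ColonPrime.of_colonGens {G : Finset (Fin n → ℕ)} {v : Fin n → ℕ} {T : Finset (Fin n)}
    (h : ColonPrime (colonGens G v) T) : ColonPrime G T := by
  obtain ⟨u, hu⟩ := h
  refine ⟨v + u, fun w => ?_⟩
  rw [← hu, monMem_colonGens, add_assoc]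

theorem ColonPrime.congr {G H : Finset (Fin n → ℕ)} {T : Finset (Fin n)}
    (hGH : ∀ w, MonMem G w ↔ MonMem H w) (h : ColonPrime G T) : ColonPrime H T := by
  obtain ⟨u, hu⟩ := h
  exact ⟨u, fun w => by rw [← hGH, hu]⟩

theorem GenericGens.erase {G : Finset (Fin n → ℕ)} (hG : GenericGens G) {a b : Fin n → ℕ}
    (ha : a ∈ G) (hab : a ≠ b) (hle : a ≤ b) : GenericGens (G.erase b) := by
  intro p hp q hq hpq h
  obtain ⟨c, hc, hcd⟩ := hG p (mem_of_mem_erase hp) q (mem_of_mem_erase hq) hpq h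
  by_cases hcb : c = b
  · refine ⟨a, mem_erase.2 ⟨hab, ha⟩, fun i hi => ?_⟩
    subst hcb
    exact (hle i).trans_lt (hcd i (hi.trans_le (hle i)))
  · exact ⟨c, mem_erase.2 ⟨hcb, hc⟩, hcd⟩

theorem monMem_erase {G : Finset (Fin n → ℕ)} {a b w : Fin n → ℕ}
    (ha : a ∈ G) (hab : a ≠ b) (hle : a ≤ b) : MonMem (G.erase b) w ↔ MonMem G w := by
  constructor
  · rintro ⟨c, hc, hcw⟩
    exact ⟨c, mem_of_mem_erase hc, hcw⟩
  · rintro ⟨c, hc, hcw⟩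
    by_cases hcb : c = b
    · exact ⟨a, mem_erase.2 ⟨hab, ha⟩, hle.trans (hcb ▸ hcw)⟩
    · exact ⟨c, mem_erase.2 ⟨hcb, hc⟩, hcw⟩

theorem monMem_insert_erase {G : Finset (Fin n → ℕ)} {g g' w : Fin n → ℕ} (hle : g' ≤ g) :
    MonMem (insert g' (G.erase g)) w ↔ MonMem (insert g' G) w := by
  rw [monMem_insert, monMem_insert]
  constructor
  · rintro (h | ⟨c, hc, hcw⟩)
    · exact Or.inl h
    · exact Or.inr ⟨c, mem_of_mem_erase hc, hcw⟩
  · rintro (h | ⟨c, hc, hcw⟩)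
    · exact Or.inl h
    · by_cases hcb : c = g
      · exact Or.inl (hle.trans (hcb ▸ hcw))
      · exact Or.inr ⟨c, mem_erase.2 ⟨hcb, hc⟩, hcw⟩

section ClearVariable

variable {G : Finset (Fin n → ℕ)} {g : Fin n → ℕ} {x : Fin n}

/-- Dividing out the full `x`-power of a generator of least positive `x`-degree keeps
genericity. -/
theorem GenericGens.insert_update (hG : GenericGens G) (hg : g ∈ G)
    (hmin : ∀ h ∈ G, 0 < h x → g x ≤ h x) :
    GenericGens (insert (Function.update g x 0) (G.erase g)) := by
  set g' := Function.update g x 0 with hg'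
  have hx : g' x = 0 := by simp [hg']
  have hne : ∀ i, i ≠ x → g' i = g i := fun i hi => by simp [hg', hi]
  have key : ∀ b ∈ G.erase g, (∃ h, g' h = b h ∧ 0 < g' h) →
      ∃ c ∈ insert g' (G.erase g), StrictlyDivides c (g' ⊔ b) := by
    rintro b hb ⟨h, hh, hpos⟩
    have hhx : h ≠ x := by rintro rfl; omega
    have := hne h hhx
    obtain ⟨c, hc, hcd⟩ := hG g hg b (mem_of_mem_erase hb) (ne_of_mem_erase hb).symm
      ⟨h, by omega, by omega⟩
    by_cases hcg : c = g
    · refine ⟨g', mem_insert_self _ _, fun i hi => ?_⟩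
      have hix : i ≠ x := by rintro rfl; omega
      have := hne i hix
      have := hcd i
      simp only [Pi.sup_apply, hcg] at *
      omega
    · refine ⟨c, mem_insert_of_mem (mem_erase.2 ⟨hcg, hc⟩), fun i hi => ?_⟩
      have h1 := hcd i hi
      simp only [Pi.sup_apply] at *
      by_cases hix : i = x
      · subst hix
        have := hmin c hc hi
        omega
      · have := hne i hix
        omega
  intro a ha b hb hab h
  rcases mem_insert.1 ha with rfl | ha
  · rcases mem_insert.1 hb with rfl | hb
    · exact absurd rfl hab
    · exact key b hb h
  · rcases mem_insert.1 hb with rfl | hb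
    · obtain ⟨h, hh, hpos⟩ := h
      rw [sup_comm]
      exact key a ha ⟨h, hh.symm, by omega⟩
    · obtain ⟨c, hc, hcd⟩ := hG a (mem_of_mem_erase ha) b (mem_of_mem_erase hb) hab h
      by_cases hcg : c = g
      · refine ⟨g', mem_insert_self _ _, fun i hi => ?_⟩
        have hix : i ≠ x := by rintro rfl; omega
        have := hne i hix
        have := hcd i
        rw [hcg] at this
        omega
      · exact ⟨c, mem_insert_of_mem (mem_erase.2 ⟨hcg, hc⟩), hcd⟩

theorem ColonPrime.of_insert_update (hG : GenericGens G) (hg : g ∈ G) (hgx : 0 < g x)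
    (hmin : ∀ h ∈ G, 0 < h x → g x ≤ h x) {T : Finset (Fin n)}
    (hT : ColonPrime (insert (Function.update g x 0) (G.erase g)) T) : ColonPrime G T := by
  obtain ⟨u, hu⟩ := hT
  set g' := Function.update g x 0 with hg'
  have hx : g' x = 0 := by simp [hg']
  have hne : ∀ i, i ≠ x → g' i = g i := fun i hi => by simp [hg', hi]
  have hle' : ∀ v, (∀ i, i ≠ x → g i ≤ v i) → g' ≤ v := fun v hv i => by
    by_cases hix : i = x
    · rw [hix, hx]; exact Nat.zero_le _
    · exact (hne i hix).trans_le (hv i hix)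
  have hle : g' ≤ g := hle' g fun i _ => le_rfl
  simp only [monMem_insert_erase hle, monMem_insert] at hu
  have hback : ∀ v, g' ≤ v → g x ≤ v x → MonMem G v := fun v hv hvx =>
    ⟨g, hg, fun i => by
      by_cases hix : i = x
      · subst hix; exact hvx
      · exact (hne i hix).symm.le.trans (hv i)⟩
  by_cases hxT : x ∈ T
  · refine ⟨u, fun w => ?_⟩
    rw [← hu]
    refine ⟨Or.inr, ?_⟩
    rintro (h | h)
    swap
    · exact h
    by_cases hwx : g x ≤ (u + w) x
    · exact hback _ h hwx
    have h0 := (hu 0).not.2 (by simp)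
    rw [add_zero] at h0
    push Not at h0
    rcases (hu (Pi.single x 1)).2 ⟨x, hxT, by simp⟩ with h1 | ⟨d, hd, hdu⟩
    · refine absurd (hle' u fun i hix => ?_) h0.1
      simpa [hix, hne i hix] using h1 i
    have hdi : ∀ i, i ≠ x → d i ≤ u i := fun i hi => by simpa [hi] using hdu i
    have hdx : d x ≤ u x + 1 := by simpa using hdu x
    have hdx' : u x < d x := by
      by_contra hcon
      refine h0.2 ⟨d, hd, fun i => ?_⟩
      by_cases hix : i = x
      · rw [hix]; exact Nat.not_lt.1 hcon
      · exact hdi i hix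
    have := hmin d hd (by omega)
    simp only [Pi.add_apply] at hwx
    have hdg : g ≠ d := by
      rintro rfl
      exact h0.1 (hle' u hdi)
    obtain ⟨c, hc, hcd⟩ := hG g hg d hd hdg ⟨x, by omega, by omega⟩
    refine ⟨c, hc, fun i => ?_⟩
    have hci := hcd i
    have hcm := hmin c hc
    simp only [Pi.sup_apply, Pi.add_apply] at *
    by_cases hix : i = x
    · subst hix; omega
    · have h2 := hne i hix
      have h3 := hdi i hix
      have h4 : g' i ≤ u i + w i := h i
      omega
  · refine ⟨u + Pi.single x (g x), fun w => ?_⟩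
    have h1 := hu (Pi.single x (g x) + w)
    have h2 : (∃ i ∈ T, 0 < (Pi.single x (g x) + w : Fin n → ℕ) i) ↔ ∃ i ∈ T, 0 < w i := by
      refine exists_congr fun i => and_congr_right fun hi => ?_
      have : i ≠ x := by rintro rfl; exact hxT hi
      simp [this]
    rw [h2, ← add_assoc] at h1
    rw [← h1]
    refine ⟨Or.inr, ?_⟩
    rintro (h | h)
    · exact hback _ h (by simp; omega)
    · exact h

/-- Replacing a pure power `x^e`, coprime to the other generators, by `x` keeps genericity. -/
theorem GenericGens.insert_single (hG : GenericGens G)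
    (hx : ∀ h ∈ G.erase g, h x = 0) (hg : 0 < g x) :
    GenericGens (insert (Pi.single x 1) (G.erase g)) := by
  intro a ha b hb hab ⟨h, hh, hpos⟩
  rcases mem_insert.1 ha with rfl | ha
  · rcases mem_insert.1 hb with rfl | hb
    · exact absurd rfl hab
    · have := hx b hb
      by_cases hhx : h = x
      · subst hhx; omega
      · simp [hhx] at hpos
  · rcases mem_insert.1 hb with rfl | hb
    · have := hx a ha
      by_cases hhx : h = x
      · subst hhx; omega
      · simp [hhx] at hh; omega
    · obtain ⟨c, hc, hcd⟩ := hG a (mem_of_mem_erase ha) b (mem_of_mem_erase hb) hab ⟨h, hh, hpos⟩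
      refine ⟨c, mem_insert_of_mem (mem_erase.2 ⟨?_, hc⟩), hcd⟩
      rintro rfl
      have := hcd x hg
      simp [hx a ha, hx b hb] at this

theorem ColonPrime.of_insert_single {e : ℕ} (he : 0 < e) (hg : Pi.single x e ∈ G)
    (hx : ∀ h ∈ G.erase (Pi.single x e), h x = 0) {T : Finset (Fin n)}
    (hT : ColonPrime (insert (Pi.single x 1) (G.erase (Pi.single x e))) T) : ColonPrime G T := by
  obtain ⟨u, hu⟩ := hT
  have hux : u x = 0 := by
    by_contra hcon
    have := (hu 0).1 (monMem_insert.2 (Or.inl (by rw [single_le_iff]; simp; omega)))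
    simp at this
  refine ⟨u + Pi.single x (e - 1), fun w => ?_⟩
  rw [← hu, monMem_insert]
  have hiff : ∀ c ∈ G.erase (Pi.single x e), c ≤ u + Pi.single x (e - 1) + w ↔ c ≤ u + w := by
    refine fun c hc => forall_congr' fun i => ?_
    by_cases hix : i = x
    · subst hix; simp [hx c hc]
    · simp [hix]
  constructor
  · rintro ⟨c, hc, hcw⟩
    by_cases hce : c = Pi.single x e
    · left
      rw [hce, single_le_iff] at hcw
      rw [single_le_iff]
      simp at hcw ⊢
      omega
    · exact Or.inr ⟨c, mem_erase.2 ⟨hce, hc⟩, (hiff c (mem_erase.2 ⟨hce, hc⟩)).1 hcw⟩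
  · rintro (h | ⟨c, hc, hcw⟩)
    · refine ⟨_, hg, ?_⟩
      rw [single_le_iff] at h ⊢
      simp at h ⊢
      omega
    · exact ⟨c, mem_of_mem_erase hc, (hiff c hc).2 hcw⟩

end ClearVariable

/-- The total degree of a set of generators. -/
def gensWeight (G : Finset (Fin n → ℕ)) : ℕ := ∑ a ∈ G, ∑ i, a i

theorem gensWeight_erase_add {G : Finset (Fin n → ℕ)} {b : Fin n → ℕ} (hb : b ∈ G) :
    gensWeight (G.erase b) + ∑ i, b i = gensWeight G :=
  sum_erase_add _ _ hb

theorem sum_lt_of_lt {a b : Fin n → ℕ} (h : a < b) : ∑ i, a i < ∑ i, b i := by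
  obtain ⟨hle, i, hi⟩ := Pi.lt_def.1 h
  exact sum_lt_sum (fun i _ => hle i) ⟨i, mem_univ i, hi⟩

theorem gensWeight_insert_erase_lt {G : Finset (Fin n → ℕ)} {a b : Fin n → ℕ} (hb : b ∈ G)
    (h : a < b) : gensWeight (insert a (G.erase b)) < gensWeight G := by
  have h1 := gensWeight_erase_add hb
  have h2 := sum_lt_of_lt h
  by_cases ha : a ∈ G.erase b
  · rw [insert_eq_of_mem ha]; omega
  · rw [gensWeight, sum_insert ha, ← gensWeight]; omega

theorem gensWeight_colonGens_lt {G : Finset (Fin n → ℕ)} {w g : Fin n → ℕ} (hg : g ∈ G)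
    (hw : w ≠ 0) (hwg : w ≤ g) : gensWeight (colonGens G w) < gensWeight G := by
  have h1 : gensWeight (colonGens G w) ≤ ∑ a ∈ G, ∑ i, (a - w) i :=
    sum_image_le_of_nonneg fun _ _ => Nat.zero_le _
  refine h1.trans_lt (sum_lt_sum (fun a _ => sum_le_sum fun i _ => Nat.sub_le _ _) ⟨g, hg, ?_⟩)
  refine sum_lt_of_lt (Pi.lt_def.2 ⟨fun i => Nat.sub_le _ _, ?_⟩)
  obtain ⟨i, hi⟩ := Function.ne_iff.1 hw
  refine ⟨i, ?_⟩
  have := hwg i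
  simp only [Pi.sub_apply, Pi.zero_apply] at *
  omega

/-- A generic monomial ideal all of whose monomial-colon primes have `q` generators has every
sequence that is weakly regular modulo all `q`-generated monomial primes as a weakly regular
sequence. -/
theorem isWeaklyRegular_monIdeal_of_genericGens {k : Type*} [Field k] {q : ℕ}
    {rs : List (MvPolynomial (Fin n) k)}
    (hrs : ∀ T : Finset (Fin n), T.card = q →
      IsWeaklyRegular (MvPolynomial (Fin n) k ⧸ monIdeal k (varGens T)) rs)
    (G : Finset (Fin n → ℕ)) (hG : GenericGens G)
    (hq : ∀ T : Finset (Fin n), ColonPrime G T → T.card = q) :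
    IsWeaklyRegular (MvPolynomial (Fin n) k ⧸ monIdeal k G) rs := by
  induction hN : gensWeight G using Nat.strong_induction_on generalizing G with
  | _ N ih =>
  subst hN
  by_cases h0 : (0 : Fin n → ℕ) ∈ G
  · exact isWeaklyRegular_monIdeal_of_monMem_zero ⟨0, h0, le_rfl⟩
  have split : ∀ g ∈ G, ∀ g' : Fin n → ℕ, g' ≠ 0 → g' < g →
      GenericGens (insert g' (G.erase g)) →
      (∀ T, ColonPrime (insert g' (G.erase g)) T → ColonPrime G T) →
      IsWeaklyRegular (MvPolynomial (Fin n) k ⧸ monIdeal k G) rs := by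
    intro g hg g' hg'0 hlt hgen hcol
    refine isWeaklyRegular_monIdeal_of_colon g' ?_ ?_
    · exact ih _ (gensWeight_colonGens_lt hg hg'0 hlt.le) _ (hG.colonGens g')
        (fun T hT => hq T hT.of_colonGens) rfl
    · rw [← monIdeal_congr fun w => monMem_insert_erase hlt.le]
      exact ih _ (gensWeight_insert_erase_lt hg hlt) _ hgen (fun T hT => hq T (hcol T hT)) rfl
  by_cases hanti : ∃ a ∈ G, ∃ b ∈ G, a ≠ b ∧ a ≤ b
  · obtain ⟨a, ha, b, hb, hab, hle⟩ := hanti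
    rw [← monIdeal_congr fun w => monMem_erase ha hab hle]
    refine ih _ ?_ _ (hG.erase ha hab hle)
      (fun T hT => hq T (hT.congr fun w => monMem_erase ha hab hle)) rfl
    have h1 := gensWeight_erase_add hb
    have h2 := sum_lt_of_lt (lt_of_le_of_ne hle hab)
    omega
  push Not at hanti
  by_cases hmix : ∃ g ∈ G, ∃ x y, x ≠ y ∧ 0 < g x ∧ 0 < g y
  · obtain ⟨g, hg, x, y, hxy, hgx, hgy⟩ := hmix
    obtain ⟨g₀, hg₀, hmin⟩ := exists_min_image (G.filter (0 < · x)) (· x)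
      ⟨g, mem_filter.2 ⟨hg, hgx⟩⟩
    obtain ⟨hg₀G, hg₀x⟩ := mem_filter.1 hg₀
    have hmin' : ∀ h ∈ G, 0 < h x → g₀ x ≤ h x := fun h hh hhx =>
      hmin h (mem_filter.2 ⟨hh, hhx⟩)
    refine split g₀ hg₀G (Function.update g₀ x 0) ?_ ?_ (hG.insert_update hg₀G hmin')
      fun T hT => hT.of_insert_update hG hg₀G hg₀x hmin'
    · intro hzero
      have hz : ∀ i, i ≠ x → g₀ i = 0 := fun i hi => by simpa [hi] using congrFun hzero i
      have hle : g₀ ≤ g := fun i => by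
        by_cases hix : i = x
        · subst hix; exact hmin' g hg hgx
        · rw [hz i hix]; exact Nat.zero_le _
      have hne : g₀ ≠ g := by
        rintro rfl
        have := hz y hxy.symm
        omega
      exact hanti g₀ hg₀G g hg hne hle
    · exact update_lt_self_iff.2 hg₀x
  push Not at hmix
  have hpure : ∀ g ∈ G, ∃ x, g = Pi.single x (g x) ∧ 0 < g x := by
    intro g hg
    obtain ⟨x, hx⟩ := Function.ne_iff.1 (ne_of_mem_of_not_mem hg h0)
    have hx : 0 < g x := Nat.pos_of_ne_zero hx
    refine ⟨x, funext fun i => ?_, hx⟩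
    by_cases hix : i = x
    · subst hix; simp
    · have := hmix g hg x i (Ne.symm hix) hx
      simp [hix]; omega
  by_cases hbig : ∃ g ∈ G, ∃ x, 2 ≤ g x
  · obtain ⟨g, hg, x, hgx⟩ := hbig
    have hgs : g = Pi.single x (g x) := by
      obtain ⟨y, hy, hy0⟩ := hpure g hg
      by_cases hxy : x = y
      · rw [hxy]; exact hy
      · have := hmix g hg x y hxy (by omega)
        omega
    have hx : ∀ h ∈ G.erase g, h x = 0 := by
      intro h hh
      by_contra hcon
      have hhG := mem_of_mem_erase hh
      have hhs : h = Pi.single x (h x) := by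
        obtain ⟨y, hy, hy0⟩ := hpure h hhG
        by_cases hxy : x = y
        · rw [hxy]; exact hy
        · have := hmix h hhG x y hxy (by omega)
          omega
      rcases le_total (h x) (g x) with hle | hle
      · exact hanti h hhG g hg (ne_of_mem_erase hh) (by rw [hhs, single_le_iff]; exact hle)
      · exact hanti g hg h hhG (ne_of_mem_erase hh).symm (by rw [hgs, single_le_iff]; exact hle)
    refine split g hg (Pi.single x 1) ?_ ?_ (hG.insert_single hx (by omega)) fun T hT => ?_
    · simp
    · refine Pi.lt_def.2 ⟨single_le_iff.2 (by omega), x, by simp; omega⟩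
    · have hg' := hg
      rw [hgs] at hg' hT hx
      exact ColonPrime.of_insert_single (by omega) hg' hx hT
  push Not at hbig
  have hvar : ∀ w, MonMem G w ↔ MonMem (varGens (univ.filter fun i => Pi.single i 1 ∈ G)) w := by
    have hone : ∀ g ∈ G, ∃ x, g = Pi.single x 1 := fun g hg => by
      obtain ⟨x, hx, hx0⟩ := hpure g hg
      have := hbig g hg x
      exact ⟨x, by rw [hx]; congr; omega⟩
    intro w
    rw [monMem_varGens]
    constructor
    · rintro ⟨g, hg, hgw⟩
      obtain ⟨x, rfl⟩ := hone g hg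
      exact ⟨x, by simpa using hg, single_le_iff.1 hgw⟩
    · rintro ⟨i, hi, hiw⟩
      exact ⟨Pi.single i 1, by simpa using hi, single_le_iff.2 hiw⟩
  rw [monIdeal_congr hvar]
  exact hrs _ (hq _ ⟨0, fun w => by rw [zero_add, hvar, monMem_varGens]⟩)

end GenericFiltration

section ScarfComplex

variable {n : ℕ} {G σ : Finset (Fin n → ℕ)} {T : Finset (Fin n)}

theorem lcmExp_le_iff {w : Fin n → ℕ} : lcmExp σ ≤ w ↔ ∀ a ∈ σ, a ≤ w := by
  refine ⟨fun h a ha i => (le_sup (f := fun a : Fin n → ℕ => a i) ha).trans (h i), fun h i => ?_⟩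
  exact Finset.sup_le fun a ha => h a ha i

theorem le_lcmExp {a : Fin n → ℕ} (ha : a ∈ σ) : a ≤ lcmExp σ :=
  lcmExp_le_iff.1 le_rfl a ha

theorem ColonPrime.vFace_compl (hT : ColonPrime G T) : VFace G Tᶜ := by
  intro a ha hsub
  obtain ⟨u, hu⟩ := hT
  obtain ⟨i, hiT, hi⟩ := (hu a).1 ⟨a, ha, le_add_self⟩
  exact mem_compl.1 (hsub (by simpa using hi)) hiT

theorem exists_lt_bound (G : Finset (Fin n → ℕ)) : ∃ D, ∀ a ∈ G, ∀ i, a i < D := by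
  refine ⟨(G.sup fun a => univ.sup a) + 1, fun a ha i => Nat.lt_succ_of_le ?_⟩
  exact (le_sup (f := a) (mem_univ i)).trans (le_sup (f := fun a => univ.sup a) ha)

theorem ColonPrime.exists_scarfFace (hG : IsGeneric G) (hT : ColonPrime G T) :
    ∃ σ, ScarfFace G σ ∧ σ.card = T.card := by
  obtain ⟨u₀, hu₀⟩ := hT
  obtain ⟨D, hD⟩ := exists_lt_bound G
  obtain ⟨u, hu, huT⟩ : ∃ u : Fin n → ℕ, (∀ w, MonMem G (u + w) ↔ ∃ i ∈ T, 0 < w i) ∧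
      ∀ i ∉ T, D ≤ u i := by
    refine ⟨u₀ + fun i => if i ∈ T then 0 else D, fun w => ?_, fun i hi => by simp [hi]⟩
    rw [add_assoc, hu₀]
    refine exists_congr fun i => and_congr_right fun hi => by simp [hi]
  have hu0 : ∀ c ∈ G, ¬ c ≤ u := fun c hc hcu => by
    simpa using (hu 0).1 ⟨c, hc, by simpa using hcu⟩
  have hex : ∀ i, i ∈ T → ∃ a ∈ G, a ≤ u + Pi.single i 1 := fun i hi =>
    (hu (Pi.single i 1)).2 ⟨i, hi, by simp⟩
  have hex : ∀ i, ∃ a : Fin n → ℕ, i ∈ T → a ∈ G ∧ u i < a i ∧ a ≤ u + 1 ∧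
      ∀ j, j ≠ i → a j ≤ u j := by
    intro i
    by_cases hi : i ∈ T
    · obtain ⟨a, ha, hau⟩ := hex i hi
      have hne : ∀ j, j ≠ i → a j ≤ u j := fun j hj => by simpa [hj] using hau j
      have hii : a i ≤ u i + 1 := by simpa using hau i
      refine ⟨a, fun _ => ⟨ha, ?_, fun j => ?_, hne⟩⟩
      · by_contra hcon
        refine hu0 a ha fun j => ?_
        by_cases hj : j = i
        · rw [hj]; exact Nat.not_lt.1 hcon
        · exact hne j hj
      · by_cases hj : j = i
        · rw [hj]; exact hii
        · exact (hne j hj).trans (Nat.le_succ _)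
    · exact ⟨0, fun h => absurd h hi⟩
  choose a ha using hex
  have hinj : ∀ i ∈ T, ∀ j ∈ T, u i < a j i → j = i := fun i hi j hj h => by
    by_contra hij
    have := (ha j hj).2.2.2 i (Ne.symm hij)
    omega
  have hlcm : lcmExp (T.image a) ≤ u + 1 := by
    rw [lcmExp_le_iff]
    intro c hc
    obtain ⟨i, hi, rfl⟩ := mem_image.1 hc
    exact (ha i hi).2.2.1
  have hmem : ∀ c ∈ G, c ≤ lcmExp (T.image a) → c ∈ T.image a := by
    intro c hc hcl
    have hcu := hu0 c hc
    rw [Pi.le_def] at hcu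
    push Not at hcu
    obtain ⟨i, hi⟩ := hcu
    have hiT : i ∈ T := by
      by_contra hiT
      have := huT i hiT
      have := hD c hc i
      omega
    by_contra hcon
    have hne : c ≠ a i := fun h => hcon (h ▸ mem_image_of_mem a hiT)
    obtain ⟨haG, hai, hau, -⟩ := ha i hiT
    have hcu := hcl.trans hlcm
    have h1 : c i ≤ u i + 1 := hcu i
    have h2 : a i i ≤ u i + 1 := hau i
    obtain ⟨c', hc', -, -, hcd⟩ := hG.2 c hc (a i) haG hne ⟨i, by omega, by omega⟩
    refine hu0 c' hc' fun j => ?_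
    have h3 : c j ≤ u j + 1 := hcu j
    have h4 : a i j ≤ u j + 1 := hau j
    have h5 : 0 < c' j → c' j < max (c j) (a i j) := hcd j
    show c' j ≤ u j
    omega
  refine ⟨T.image a, ⟨?_, fun τ hτ hne heq => hne (Subset.antisymm ?_ ?_)⟩, ?_⟩
  · intro c hc
    obtain ⟨i, hi, rfl⟩ := mem_image.1 hc
    exact (ha i hi).1
  · exact fun c hc => hmem c (hτ hc) (heq ▸ le_lcmExp hc)
  · intro c hc
    obtain ⟨i, hi, rfl⟩ := mem_image.1 hc
    have h1 : u i < lcmExp τ i := by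
      rw [heq]
      exact (ha i hi).2.1.trans_le (le_lcmExp hc i)
    obtain ⟨c, hcτ, hci⟩ := Finset.lt_sup_iff.1 h1
    obtain ⟨j, hj, rfl⟩ := mem_image.1 (hmem c (hτ hcτ) (heq ▸ le_lcmExp hcτ))
    rwa [hinj i hi j hj hci] at hcτ
  · refine card_image_of_injOn fun i hi j hj hij => ?_
    have h := (ha i hi).2.1
    rw [hij] at h
    exact (hinj i hi j hj h).symm

theorem ScarfFace.exists_unique_max (hσ : ScarfFace G σ) {a : Fin n → ℕ} (ha : a ∈ σ) :
    ∃ i, 0 < a i ∧ lcmExp σ i = a i ∧ ∀ b ∈ σ, b ≠ a → b i < a i := by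
  have hne := hσ.2 (σ.erase a) ((erase_subset _ _).trans hσ.1)
    (fun h => notMem_erase a σ (h.symm ▸ ha))
  obtain ⟨i, hi⟩ := Function.ne_iff.1 hne
  have hsup : lcmExp σ i = max (a i) (lcmExp (σ.erase a) i) := by
    conv_lhs => rw [← insert_erase ha]
    exact sup_insert
  have hlt : lcmExp (σ.erase a) i < a i := by
    by_contra hcon
    exact hi (hsup.trans (max_eq_right (not_lt.1 hcon))).symm
  exact ⟨i, by omega, by omega, fun b hb hba =>
    (le_lcmExp (mem_erase.2 ⟨hba, hb⟩) i).trans_lt hlt⟩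

theorem ScarfFace.not_strictlyDivides (hσ : ScarfFace G σ) {c : Fin n → ℕ} (hc : c ∈ G) :
    ¬ StrictlyDivides c (lcmExp σ) := by
  intro hcd
  have hle : c ≤ lcmExp σ := fun i => by
    have := hcd i
    show c i ≤ lcmExp σ i
    omega
  have hins : lcmExp (insert c σ) = lcmExp σ := funext fun i =>
    sup_insert.trans (max_eq_right (hle i))
  have hcσ : c ∈ σ := by
    by_contra hcon
    exact hσ.2 (insert c σ) (insert_subset hc hσ.1)
      (fun h => hcon (h ▸ mem_insert_self c σ)) hins
  obtain ⟨i, hi, hmax, -⟩ := hσ.exists_unique_max hcσ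
  have := hcd i hi
  omega

theorem ScarfFace.exists_colonPrime (hG : IsGeneric G) (hσ : ScarfFace G σ) :
    ∃ T, ColonPrime G T ∧ σ.card ≤ T.card := by
  obtain ⟨D, hD⟩ := exists_lt_bound (insert 0 G)
  choose f hfpos hfmax hflt using fun (a) (ha : a ∈ σ) => hσ.exists_unique_max ha
  set m := lcmExp σ with hm
  have hDG : ∀ a ∈ G, ∀ i, a i < D := fun a ha => hD a (mem_insert_of_mem ha)
  have hmD : ∀ i, m i < D := fun i => by
    rw [hm, lcmExp, Finset.sup_lt_iff ((Nat.zero_le _).trans_lt (hD 0 (mem_insert_self _ _) i))]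
    exact fun a ha => hDG a (hσ.1 ha) i
  let A := (Icc m fun _ => D).filter fun v =>
    (∀ a (ha : a ∈ σ), v (f a ha) = m (f a ha)) ∧ ∀ c ∈ G, ¬ StrictlyDivides c v
  obtain ⟨v, hv⟩ := A.exists_maximal ⟨m, mem_filter.2 ⟨mem_Icc.2 ⟨le_rfl, fun i => (hmD i).le⟩,
    fun _ _ => rfl, fun c hc => hσ.not_strictlyDivides hc⟩⟩
  obtain ⟨hvI, hvf, hvG⟩ := mem_filter.1 hv.prop
  obtain ⟨hmv, hvD⟩ := mem_Icc.1 hvI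
  have hblock : ∀ j, v j < D → (∀ a ha, f a ha ≠ j) →
      ∃ c ∈ G, 0 < c j ∧ c j = v j ∧ ∀ i, i ≠ j → 0 < c i → c i < v i := by
    intro j hj hjf
    by_contra hcon
    push Not at hcon
    have hmem : v + Pi.single j 1 ∈ A := by
      refine mem_filter.2 ⟨mem_Icc.2 ⟨hmv.trans le_self_add, fun i => ?_⟩, ?_, ?_⟩
      · by_cases hij : i = j
        · subst hij; simpa using hj
        · simpa [hij] using hvD i
      · intro a ha
        simp [hjf a ha, hvf a ha]
      · intro c hc hcd
        have hne : ∀ i, i ≠ j → 0 < c i → c i < v i := fun i hij hi => by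
          simpa [hij] using hcd i hi
        have hcj : 0 < c j → c j < v j + 1 := fun h => by simpa using hcd j h
        refine hvG c hc fun i hi => ?_
        by_cases hij : i = j
        · subst hij
          by_contra hlt
          obtain ⟨i', h1, h2, h3⟩ := hcon c hc hi (by have := hcj hi; omega)
          exact absurd (hne i' h1 h2) (by omega)
        · exact hne i hij hi
    have := hv.le_of_ge hmem le_self_add j
    simp at this
  have hvpos : ∀ j, 0 < v j := by
    intro j
    by_cases hjf : ∀ a ha, f a ha ≠ j
    · by_cases hj : v j < D
      · obtain ⟨c, -, h1, h2, -⟩ := hblock j hj hjf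
        omega
      · have := hmD j
        omega
    · push Not at hjf
      obtain ⟨a, ha, rfl⟩ := hjf
      rw [hvf, hfmax]
      exact hfpos a ha
  obtain ⟨u, hu⟩ : ∃ u : Fin n → ℕ, ∀ i, v i = u i + 1 :=
    ⟨fun i => v i - 1, fun i => (Nat.sub_add_cancel (hvpos i)).symm⟩
  have hu0 : ∀ c ∈ G, ¬ c ≤ u := fun c hc hcu => hvG c hc fun i _ => by
    have : c i ≤ u i := hcu i
    have := hu i
    omega
  refine ⟨univ.filter fun i => v i < D, ⟨u, fun w => ⟨?_, ?_⟩⟩, ?_⟩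
  · rintro ⟨c, hc, hcw⟩
    by_contra hcon
    push Not at hcon
    refine hu0 c hc fun i => ?_
    have h1 : c i ≤ u i + w i := hcw i
    have h2 := hu i
    have h3 := hDG c hc i
    have h4 := hcon i
    simp only [mem_filter, mem_univ, true_and] at h4
    show c i ≤ u i
    by_cases h5 : v i < D
    · have := h4 h5
      omega
    · omega
  · rintro ⟨i, hi, hiw⟩
    have hiD : v i < D := by simpa using hi
    suffices ∃ c ∈ G, c i ≤ v i ∧ ∀ j, j ≠ i → 0 < c j → c j < v j by
      obtain ⟨c, hc, hci, hcj⟩ := this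
      refine ⟨c, hc, fun j => ?_⟩
      have := hu j
      show c j ≤ u j + w j
      by_cases hji : j = i
      · rw [hji] at this ⊢; omega
      · have := hcj j hji
        omega
    by_cases hif : ∀ a ha, f a ha ≠ i
    · obtain ⟨c, hc, -, h1, h2⟩ := hblock i hiD hif
      exact ⟨c, hc, h1.le, h2⟩
    push Not at hif
    obtain ⟨a, ha, rfl⟩ := hif
    have hvi := (hvf a ha).trans (hfmax a ha)
    refine ⟨a, hσ.1 ha, hvi.ge, fun l hl hal => ?_⟩
    by_contra hcon
    have hal_le : a l ≤ m l := le_lcmExp ha l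
    have hml : m l ≤ v l := hmv l
    by_cases hlf : ∀ b hb, f b hb ≠ l
    · obtain ⟨c, hc, h1, h2, h3⟩ := hblock l (by have := hDG a (hσ.1 ha) l; omega) hlf
      have hne : a ≠ c := by
        rintro rfl
        have := h3 _ hl.symm (hfpos a ha)
        omega
      obtain ⟨c', hc', -, -, hcd⟩ := hG.2 a (hσ.1 ha) c hc hne ⟨l, by omega, hal⟩
      refine hvG c' hc' fun j hj => (hcd j hj).trans_le (max_le ?_ ?_)
      · exact (le_lcmExp ha j).trans (hmv j)
      · by_cases hjl : j = l
        · subst hjl; exact h2.le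
        · have := h3 j hjl
          omega
    · push Not at hlf
      obtain ⟨b, hb, rfl⟩ := hlf
      have hab : a ≠ b := by rintro rfl; exact hl rfl
      have h1 := hflt b hb a ha hab
      have h2 := hvf b hb
      have h3 := hfmax b hb
      omega
  · refine card_le_card_of_forall_subsingleton (fun a i => ∀ b ∈ σ, b ≠ a → b i < a i)
      (fun a ha => ⟨f a ha, ?_, hflt a ha⟩) fun i _ a ha b hb => ?_
    · simpa [hvf a ha] using hmD _
    · by_contra hab
      have h1 := ha.2 b hb.1 (Ne.symm hab)
      have h2 := hb.2 a ha.1 hab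
      omega

theorem scarfFace_empty (h0 : ∀ a ∈ G, a ≠ 0) : ScarfFace G ∅ := by
  refine ⟨empty_subset _, fun τ hτ hne heq => ?_⟩
  obtain ⟨a, ha⟩ := nonempty_iff_ne_empty.2 hne
  refine h0 a (hτ ha) (le_antisymm ?_ fun _ => Nat.zero_le _)
  exact (le_lcmExp ha).trans (heq.trans rfl).le

end ScarfComplex

section Dimension

open MvPolynomial

variable {n : ℕ}

theorem ringKrullDim_quotient_add_le {R : Type*} [CommRing R] {I : Ideal R} {c d : ℕ}
    (hc : ∀ P : Ideal R, P.IsPrime → I ≤ P → (c : ℕ∞) ≤ P.height)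
    (hR : ringKrullDim R ≤ (c + d : ℕ)) : ringKrullDim (R ⧸ I) ≤ (d : ℕ) := by
  rw [ringKrullDim_quotient]
  refine iSup_le fun l => ?_
  have key : ∀ j (hj : j < l.length + 1), ((c + j : ℕ) : ℕ∞) ≤ (l ⟨j, hj⟩).1.asIdeal.height := by
    intro j
    induction j with
    | zero => exact fun hj => hc _ (l ⟨0, hj⟩).1.isPrime (l ⟨0, hj⟩).2
    | succ j ih =>
      intro hj
      have hlt : (l ⟨j, by omega⟩).1.asIdeal < (l ⟨j + 1, hj⟩).1.asIdeal :=
        l.strictMono (show (⟨j, by omega⟩ : Fin (l.length + 1)) < ⟨j + 1, hj⟩ by simp)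
      refine le_trans ?_ (Ideal.height_add_one_le_of_lt_of_isPrime hlt)
      rw [← add_assoc, Nat.cast_succ]
      gcongr
      exact ih _
  have h1 := key l.length (by omega)
  have h2 : ((l ⟨l.length, by omega⟩).1.asIdeal.height : WithBot ℕ∞) ≤ ringKrullDim R :=
    Ideal.height_le_ringKrullDim_of_ne_top (l ⟨l.length, by omega⟩).1.isPrime.ne_top
  have h3 : ((c + l.length : ℕ) : WithBot ℕ∞) ≤ (c + d : ℕ) :=
    ((WithBot.coe_le_coe.2 h1).trans h2).trans hR
  have h4 : c + l.length ≤ c + d := by exact_mod_cast h3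
  have h5 : l.length ≤ d := by omega
  exact_mod_cast h5

variable {k : Type*} [Field k]

theorem ringKrullDim_mvPolynomial_field (σ : Type*) [Finite σ] :
    ringKrullDim (MvPolynomial σ k) = (Nat.card σ : ℕ) := by
  rw [MvPolynomial.ringKrullDim_of_isNoetherianRing, ringKrullDim_eq_zero_of_field, zero_add]

theorem height_le_of_isPrime (P : Ideal (MvPolynomial (Fin n) k)) [hP : P.IsPrime] :
    P.height ≤ n := by
  have h := Ideal.height_le_ringKrullDim_of_ne_top hP.ne_top
  rw [ringKrullDim_mvPolynomial_field, Nat.card_fin] at h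
  exact_mod_cast h

theorem card_le_height_varGens (T : Finset (Fin n)) :
    (T.card : ℕ∞) ≤ (monIdeal k (varGens T)).height := by
  induction T using Finset.induction_on with
  | empty => simp
  | insert i T hi ih =>
    have hlt : monIdeal k (varGens T) < monIdeal k (varGens (insert i T)) := by
      refine SetLike.lt_iff_le_and_exists.2 ⟨monIdeal_le_of_forall fun w hw => ?_, X i, ?_, ?_⟩
      · rw [monMem_varGens] at hw ⊢
        obtain ⟨j, hj, hjw⟩ := hw
        exact ⟨j, mem_insert_of_mem hj, hjw⟩
      · exact X_mem_monIdeal_varGens.2 (mem_insert_self i T)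
      · exact X_mem_monIdeal_varGens.not.2 hi
    rw [card_insert_of_notMem hi, Nat.cast_succ]
    exact (add_le_add_left ih 1).trans (Ideal.height_add_one_le_of_lt_of_isPrime hlt)

theorem mono_eq_prod (a : Fin n → ℕ) : mono k a = ∏ i, X i ^ a i := by
  rw [mono, MvPolynomial.monomial_eq, C_1, one_mul, Finsupp.prod_fintype _ _ fun i => pow_zero _]
  rfl

/-- The largest cardinality of a face of `V(M)`. -/
noncomputable def maxVFace (G : Finset (Fin n → ℕ)) : ℕ :=
  ((univ : Finset (Finset (Fin n))).filter (fun σ => VFace G σ)).sup card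

theorem VFace.card_le {G : Finset (Fin n → ℕ)} {F : Finset (Fin n)} (hF : VFace G F) :
    F.card ≤ maxVFace G :=
  le_sup (f := card) (mem_filter.2 ⟨mem_univ F, hF⟩)

theorem exists_vFace_card_eq {G : Finset (Fin n → ℕ)} (h0 : ∀ a ∈ G, a ≠ 0) :
    ∃ F, VFace G F ∧ F.card = maxVFace G := by
  have hempty : VFace G ∅ := fun a ha hsub => h0 a ha <| funext fun i => by
    by_contra hi
    exact notMem_empty i (hsub (mem_filter.2 ⟨mem_univ i, Nat.pos_of_ne_zero hi⟩))
  obtain ⟨F, hF, hcard⟩ := exists_mem_eq_sup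
    ((univ : Finset (Finset (Fin n))).filter (fun σ => VFace G σ))
    ⟨∅, mem_filter.2 ⟨mem_univ _, hempty⟩⟩ card
  exact ⟨F, (mem_filter.1 hF).2, hcard.symm⟩

theorem ringKrullDim_quotient_monIdeal {G : Finset (Fin n → ℕ)} (h0 : ∀ a ∈ G, a ≠ 0) :
    ringKrullDim (MvPolynomial (Fin n) k ⧸ monIdeal k G) = (maxVFace G : ℕ) := by
  obtain ⟨F, hF, hcard⟩ := exists_vFace_card_eq h0
  refine le_antisymm (ringKrullDim_quotient_add_le (c := n - maxVFace G) (fun P hP hIP => ?_) ?_) ?_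
  · set T : Finset (Fin n) := univ.filter fun i => X i ∈ P with hT
    have hface : VFace G Tᶜ := by
      intro a ha hsub
      have hmem : mono k a ∈ P := hIP (Ideal.subset_span ⟨a, ha, rfl⟩)
      rw [mono_eq_prod, hP.prod_mem_iff] at hmem
      obtain ⟨i, -, hi⟩ := hmem
      have hpos : 0 < a i := by
        by_contra h
        rw [Nat.eq_zero_of_not_pos h, pow_zero] at hi
        exact hP.ne_top ((Ideal.eq_top_iff_one _).2 hi)
      have := hsub (mem_filter.2 ⟨mem_univ i, hpos⟩)
      exact mem_compl.1 this (mem_filter.2 ⟨mem_univ i, hP.mem_of_pow_mem _ hi⟩)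
    have hle : monIdeal k (varGens T) ≤ P := by
      rw [monIdeal_varGens_eq_span, Ideal.span_le]
      rintro _ ⟨i, hi, rfl⟩
      exact (mem_filter.1 hi).2
    have h1 := hface.card_le
    rw [card_compl, Fintype.card_fin] at h1
    refine le_trans ?_ ((card_le_height_varGens T).trans (Ideal.height_mono hle))
    exact_mod_cast (by omega : n - maxVFace G ≤ T.card)
  · rw [ringKrullDim_mvPolynomial_field, Nat.card_fin]
    exact_mod_cast (by omega : n ≤ n - maxVFace G + maxVFace G)
  · let f : MvPolynomial (Fin n) k →ₐ[k] MvPolynomial F k :=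
      aeval fun i => if h : i ∈ F then X ⟨i, h⟩ else 0
    have hf : Function.Surjective f := by
      intro p
      refine ⟨rename Subtype.val p, ?_⟩
      simp only [f, aeval_rename]
      convert aeval_X_left_apply p using 2
      ext i
      simp
    have hker : ∀ p ∈ monIdeal k G, f p = 0 := by
      intro p hp
      have hle : monIdeal k G ≤ RingHom.ker f := by
        rw [monIdeal, Ideal.span_le]
        rintro _ ⟨a, ha, rfl⟩
        obtain ⟨i, hi, hiF⟩ := not_subset.1 (hF a ha)
        simp only [SetLike.mem_coe, RingHom.mem_ker, mono_eq_prod, map_prod, map_pow]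
        refine prod_eq_zero (mem_univ i) ?_
        simp [f, hiF, (mem_filter.1 hi).2.ne']
      exact hle hp
    have h := ringKrullDim_le_of_surjective (Ideal.Quotient.lift (monIdeal k G) f.toRingHom hker)
      (Ideal.Quotient.lift_surjective_of_surjective _ _ hf)
    rw [ringKrullDim_mvPolynomial_field] at h
    rwa [Nat.card_eq_fintype_card, Fintype.card_coe, hcard] at h

end Dimension

section Main

open MvPolynomial RingTheory.Sequence

variable {n : ℕ} {k : Type*} [Field k]

theorem ColonPrime.mem_associatedPrimes {G : Finset (Fin n → ℕ)} {T : Finset (Fin n)}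
    (hT : ColonPrime G T) : monIdeal k (varGens T) ∈
      associatedPrimes (MvPolynomial (Fin n) k) (MvPolynomial (Fin n) k ⧸ monIdeal k G) := by
  obtain ⟨u, hu⟩ := hT
  refine isAssociatedPrime_iff.2 ⟨inferInstance, Ideal.Quotient.mk _ (mono k u), ?_⟩
  ext p
  have hmem : p ∈ Submodule.colon ⊥ {Ideal.Quotient.mk (monIdeal k G) (mono k u)} ↔
      mono k u * p ∈ monIdeal k G := by
    rw [Submodule.mem_colon_singleton, Submodule.mem_bot, mul_comm]
    exact Ideal.Quotient.eq_zero_iff_mem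
  rw [hmem, mono_mul_mem_monIdeal, monIdeal_congr fun w => ?_]
  rw [monMem_colonGens, hu, monMem_varGens]

theorem esymmSeq_mem {d : ℕ} : ∀ r ∈ esymmSeq k n d, r ∈ Ideal.span (Set.range X) := by
  induction d with
  | zero => simp [esymmSeq]
  | succ d ih =>
    intro r hr
    rcases List.mem_cons.1 hr with rfl | hr
    · refine Ideal.sum_mem _ fun A hA => ?_
      obtain ⟨i, hi⟩ : A.Nonempty := card_pos.1 (by rw [(mem_powersetCard.1 hA).2]; omega)
      exact Ideal.mem_of_dvd _ (dvd_prod_of_mem X hi) (Ideal.subset_span ⟨i, rfl⟩)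
    · exact ih r hr

/-- The largest cardinality of a face of the Scarf complex. -/
noncomputable def maxScarfFace (G : Finset (Fin n → ℕ)) : ℕ :=
  (G.powerset.filter (fun σ => ScarfFace G σ)).sup card

theorem ScarfFace.card_le {G σ : Finset (Fin n → ℕ)} (hσ : ScarfFace G σ) :
    σ.card ≤ maxScarfFace G :=
  le_sup (f := card) (mem_filter.2 ⟨mem_powerset.2 hσ.1, hσ⟩)

theorem exists_scarfFace_card_eq {G : Finset (Fin n → ℕ)} (h0 : ∀ a ∈ G, a ≠ 0) :
    ∃ σ, ScarfFace G σ ∧ σ.card = maxScarfFace G := by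
  obtain ⟨σ, hσ, hcard⟩ := exists_mem_eq_sup (G.powerset.filter (fun σ => ScarfFace G σ))
    ⟨∅, mem_filter.2 ⟨empty_mem_powerset G, scarfFace_empty h0⟩⟩ card
  exact ⟨σ, (mem_filter.1 hσ).2, hcard.symm⟩

theorem ColonPrime.le_card_add {G : Finset (Fin n → ℕ)} {T : Finset (Fin n)}
    (hT : ColonPrime G T) : n ≤ T.card + maxVFace G := by
  have h := hT.vFace_compl.card_le
  rw [card_compl, Fintype.card_fin] at h
  omega

theorem ColonPrime.card_le {G : Finset (Fin n → ℕ)} {T : Finset (Fin n)} (hG : IsGeneric G)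
    (hT : ColonPrime G T) : T.card ≤ maxScarfFace G := by
  obtain ⟨σ, hσ, hcard⟩ := hT.exists_scarfFace hG
  exact hcard ▸ hσ.card_le

theorem span_range_X_eq :
    Ideal.span (Set.range (X : Fin n → MvPolynomial (Fin n) k)) = monIdeal k (varGens univ) := by
  rw [monIdeal_varGens_eq_span, coe_univ, Set.image_univ]

theorem maxScarfFace_add_of_isCMQuotient {G : Finset (Fin n → ℕ)} (h0 : ∀ a ∈ G, a ≠ 0)
    (hgen : IsGeneric G) (hCM : IsCMQuotient k (monIdeal k G)) :
    maxScarfFace G + maxVFace G = n := by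
  obtain ⟨rs, hrs, hreg, hlen⟩ := hCM
  have hlen' : ((rs.length : ℕ) : WithBot ℕ∞) = (maxVFace G : ℕ) :=
    hlen.trans (ringKrullDim_quotient_monIdeal h0)
  have hlen : rs.length = maxVFace G := by exact_mod_cast hlen'
  obtain ⟨σ, hσ, hcard⟩ := exists_scarfFace_card_eq h0
  obtain ⟨T, hT, hσT⟩ := hσ.exists_colonPrime hgen
  have hweak : IsWeaklyRegular (MvPolynomial (Fin n) k ⧸ monIdeal k G) rs :=
    (isWeaklyRegular_map_algebraMap_iff (S := MvPolynomial (Fin n) k ⧸ monIdeal k G) _ rs).1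
      hreg.toIsWeaklyRegular
  rw [span_range_X_eq] at hrs
  have h1 := height_add_length_le_of_isWeaklyRegular hrs hweak
    (hT.mem_associatedPrimes (k := k)) (monIdeal_le_of_forall fun w hw => by
      rw [monMem_varGens] at hw ⊢
      obtain ⟨i, -, hi⟩ := hw
      exact ⟨i, mem_univ i, hi⟩)
  have h2 : ((T.card + rs.length : ℕ) : ℕ∞) ≤ n := by
    push_cast
    exact (add_le_add_left (card_le_height_varGens T) _).trans (h1.trans (height_le_of_isPrime _))
  have h3 : T.card + rs.length ≤ n := by exact_mod_cast h2
  have h4 := hT.le_card_add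
  have h5 := hT.card_le hgen
  omega

theorem isCMQuotient_of_maxScarfFace_add {G : Finset (Fin n → ℕ)} (h0 : ∀ a ∈ G, a ≠ 0)
    (hgen : IsGeneric G) (h : maxScarfFace G + maxVFace G = n) :
    IsCMQuotient k (monIdeal k G) := by
  refine ⟨esymmSeq k n (maxVFace G), esymmSeq_mem, ⟨?_, ?_⟩, ?_⟩
  · refine (isWeaklyRegular_map_algebraMap_iff (S := MvPolynomial (Fin n) k ⧸ monIdeal k G) _ _).2 ?_
    refine isWeaklyRegular_monIdeal_of_genericGens (q := maxScarfFace G)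
      (fun T hT => isWeaklyRegular_esymmSeq _ T (by omega)) G hgen.genericGens fun T hT => ?_
    have h4 := hT.le_card_add
    have h5 := hT.card_le hgen
    omega
  · rw [smul_eq_mul, Ideal.mul_top]
    intro htop
    have hle : Ideal.ofList ((esymmSeq k n (maxVFace G)).map (Ideal.Quotient.mk (monIdeal k G))) ≤
        (monIdeal k (varGens univ)).map (Ideal.Quotient.mk (monIdeal k G)) := by
      rw [Ideal.ofList, Ideal.span_le]
      intro r hr
      obtain ⟨p, hp, rfl⟩ := List.mem_map.1 hr
      exact Ideal.mem_map_of_mem _ (span_range_X_eq (k := k) ▸ esymmSeq_mem p hp)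
    have hmap := eq_top_iff.2 (htop.le.trans hle)
    refine (Ideal.map_isPrime_of_surjective Ideal.Quotient.mk_surjective ?_).ne_top hmap
    rw [Ideal.mk_ker]
    refine monIdeal_le_of_forall fun w ⟨a, ha, haw⟩ => monMem_varGens.2 ?_
    obtain ⟨i, hi⟩ := Function.ne_iff.1 (h0 a ha)
    exact ⟨i, mem_univ i, (Nat.pos_of_ne_zero hi).trans_le (haw i)⟩
  · rw [length_esymmSeq]
    exact (ringKrullDim_quotient_monIdeal h0).symm

end Main

/-- A generic monomial ideal `M` in `k[x_1,…,x_n]` is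
Cohen-Macaulay if and only if `dim Δ_M + dim V(M) = n - 2`. -/
theorem generic_CM_iff_dim {k : Type*} [Field k] {n : ℕ}
    (G : Finset (Fin n → ℕ)) (hG : G.Nonempty) (h0 : ∀ a ∈ G, a ≠ 0)
    (hgen : IsGeneric G) :
    IsCMQuotient k (monIdeal k G) ↔ scarfDim G + vDim G = (n : ℤ) - 2 := by
  have hdim : scarfDim G + vDim G = (n : ℤ) - 2 ↔ maxScarfFace G + maxVFace G = n := by
    rw [scarfDim, vDim, powerset_univ]
    change ((maxScarfFace G : ℕ) : ℤ) - 1 + (((maxVFace G : ℕ) : ℤ) - 1) = _ ↔ _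
    omega
  rw [hdim]
  exact ⟨maxScarfFace_add_of_isCMQuotient h0 hgen, isCMQuotient_of_maxScarfFace_add h0 hgen⟩
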